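/- arXiv:2208.11239 — 10 statements merged into one kernel-verified Lean document; each statement's English description precedes it below -/
import Mathlib

section
/- Let X be a real Banach space of dimension at least 2. Then 0 ≤ S_P(X) ≤ 1/2. -/
/-- The P-angle constant `S_P(X)`. -/
noncomputable def SP (X : Type*) [NormedAddCommGroup X] [NormedSpace ℝ X] : ℝ :=
  sSup {r : ℝ | ∃ x y : X, ‖x‖ = 1 ∧ ‖y‖ = 1 ∧ x ≠ y ∧ x ≠ -y ∧
    r = (‖x + y‖ ^ 2 + ‖x - y‖ ^ 2 - 4) / (2 * ‖x + y‖ * ‖x - y‖)}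

/-- The parallelogram defect of two unit vectors is at most half the product of the diagonals. -/
theorem sphere_quotient_le_half {X : Type*} [NormedAddCommGroup X] {x y : X}
    (hx : ‖x‖ = 1) (hy : ‖y‖ = 1) (hne : x ≠ y) (hne' : x ≠ -y) :
    (‖x + y‖ ^ 2 + ‖x - y‖ ^ 2 - 4) / (2 * ‖x + y‖ * ‖x - y‖) ≤ 1 / 2 := by
  have ha : 0 < ‖x + y‖ := norm_pos_iff.2 fun h => hne' (eq_neg_of_add_eq_zero_left h)
  have hb : 0 < ‖x - y‖ := norm_pos_iff.2 (sub_ne_zero.2 hne)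
  have ha2 : ‖x + y‖ ≤ 2 := (norm_add_le x y).trans (by linarith)
  have hb2 : ‖x - y‖ ≤ 2 := (norm_sub_le x y).trans (by linarith)
  rw [div_le_iff₀ (by positivity)]
  rcases le_total ‖x - y‖ ‖x + y‖ with h | h <;> nlinarith

/-- A real normed space of dimension at least two contains a pair of unit vectors which are
isosceles orthogonal. -/
theorem exists_unit_isosceles_orthogonal (X : Type*) [NormedAddCommGroup X] [NormedSpace ℝ X]
    (hdim : 1 < Module.rank ℝ X) :
    ∃ x y : X, ‖x‖ = 1 ∧ ‖y‖ = 1 ∧ ‖x + y‖ = ‖x - y‖ := by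
  have : Nontrivial X := rank_pos_iff_nontrivial.1 (zero_lt_one.trans hdim)
  obtain ⟨x, hx⟩ := exists_norm_eq X (zero_le_one (α := ℝ))
  have hcon := isPreconnected_sphere hdim (0 : X) 1
  obtain ⟨y, hy, h⟩ := hcon.intermediate_value₂ (a := -x) (b := x)
    (f := fun y => ‖x + y‖) (g := fun y => ‖x - y‖) (by simp [hx]) (by simp [hx])
    (by fun_prop) (by fun_prop) (by simp) (by simp)
  exact ⟨x, y, hx, by simpa using hy, h⟩

/-- A real normed space of dimension at least two contains a pair of isosceles orthogonal unit
vectors whose sum has norm at least `√2`. -/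
theorem exists_unit_isosceles_orthogonal_two_le (X : Type*) [NormedAddCommGroup X]
    [NormedSpace ℝ X] (hdim : 1 < Module.rank ℝ X) :
    ∃ x y : X, ‖x‖ = 1 ∧ ‖y‖ = 1 ∧ ‖x + y‖ = ‖x - y‖ ∧ 2 ≤ ‖x + y‖ ^ 2 := by
  obtain ⟨x, y, hx, hy, h⟩ := exists_unit_isosceles_orthogonal X hdim
  by_cases h2 : 2 ≤ ‖x + y‖ ^ 2
  · exact ⟨x, y, hx, hy, h, h2⟩
  have hadd : (x + y) + (x - y) = (2 : ℝ) • x := by rw [two_smul]; abel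
  have hsub : (x + y) - (x - y) = (2 : ℝ) • y := by rw [two_smul]; abel
  have ha : 0 < ‖x + y‖ := by
    have := norm_add_le (x + y) (x - y)
    rw [hadd, norm_smul, hx, ← h] at this
    norm_num at this
    linarith
  set a := ‖x + y‖ with ha'
  have hn1 : ‖a⁻¹ • (x + y) + a⁻¹ • (x - y)‖ = a⁻¹ * 2 := by
    rw [← smul_add, hadd, norm_smul, norm_smul, hx, Real.norm_of_nonneg (by positivity)]
    norm_num
  have hn2 : ‖a⁻¹ • (x + y) - a⁻¹ • (x - y)‖ = a⁻¹ * 2 := by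
    rw [← smul_sub, hsub, norm_smul, norm_smul, hy, Real.norm_of_nonneg (by positivity)]
    norm_num
  refine ⟨a⁻¹ • (x + y), a⁻¹ • (x - y), ?_, ?_, hn1.trans hn2.symm, ?_⟩
  · rw [norm_smul, Real.norm_of_nonneg (by positivity), ← ha', inv_mul_cancel₀ ha.ne']
  · rw [norm_smul, Real.norm_of_nonneg (by positivity), ← h, inv_mul_cancel₀ ha.ne']
  · rw [hn1, inv_mul_eq_div, div_pow, le_div_iff₀ (by positivity)]
    linarith

theorem stmt_0 (X : Type*) [NormedAddCommGroup X] [NormedSpace ℝ X] [CompleteSpace X]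
    (hdim : 2 ≤ Module.rank ℝ X) :
    0 ≤ SP X ∧ SP X ≤ 1 / 2 := by
  have hub : ∀ r ∈ {r : ℝ | ∃ x y : X, ‖x‖ = 1 ∧ ‖y‖ = 1 ∧ x ≠ y ∧ x ≠ -y ∧
      r = (‖x + y‖ ^ 2 + ‖x - y‖ ^ 2 - 4) / (2 * ‖x + y‖ * ‖x - y‖)}, r ≤ 1 / 2 := by
    rintro r ⟨x, y, hx, hy, hne, hne', rfl⟩
    exact sphere_quotient_le_half hx hy hne hne'
  obtain ⟨x, y, hx, hy, h, h2⟩ :=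
    exists_unit_isosceles_orthogonal_two_le X (Cardinal.one_lt_two.trans_le hdim)
  refine ⟨le_csSup_of_le ⟨1 / 2, hub⟩ ⟨x, y, hx, hy, ?_, ?_, rfl⟩ ?_,
    Real.sSup_le hub (by norm_num)⟩
  · rintro rfl
    rw [h] at h2
    norm_num at h2
  · rintro rfl
    norm_num at h2
  · rw [← h]
    exact div_nonneg (by linarith) (by positivity)
end

section
/- Let X be a real Banach space of dimension at least 2. Then the norm of X arises from an inner product (equivalently, X satisfies the parallelogram law ‖x+y‖² + ‖x−y‖² = 2‖x‖² + 2‖y‖² for all x, y ∈ X) if and only if S_P(X) = 0. -/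
/-- A closed set of angles that is invariant under translation by `π`, closed under taking
midpoints of angles at distance less than `π`, and contains two angles at distance strictly between
`0` and `π`, is everything. -/
theorem eq_univ_of_isClosed_of_midpoint {A : Set ℝ} (hA : IsClosed A)
    (hper : ∀ t (k : ℤ), t + k * Real.pi ∈ A ↔ t ∈ A)
    (hmid : ∀ s t, s ∈ A → t ∈ A → s < t → t < s + Real.pi → (s + t) / 2 ∈ A)
    {α β : ℝ} (hα : α ∈ A) (hβ : β ∈ A) (hαβ : α < β) (hβα : β < α + Real.pi) :
    A = Set.univ := by
  have hIcc : ∀ a b, a ∈ A → b ∈ A → a < b → b < a + Real.pi → Set.Icc a b ⊆ A := by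
    intro a b ha hb hab hba t ht
    by_contra htA
    have hc1 : IsCompact (A ∩ Set.Icc a t) := isCompact_Icc.inter_left hA
    have hc2 : IsCompact (A ∩ Set.Icc t b) := isCompact_Icc.inter_left hA
    obtain ⟨p, ⟨hpA, hp⟩, hpmax⟩ := hc1.exists_isGreatest ⟨a, ha, le_refl a, ht.1⟩
    obtain ⟨q, ⟨hqA, hq⟩, hqmin⟩ := hc2.exists_isLeast ⟨b, hb, ht.2, le_refl b⟩
    have hpt : p < t := lt_of_le_of_ne hp.2 (fun h => htA (h ▸ hpA))
    have htq : t < q := lt_of_le_of_ne hq.1 (fun h => htA (h ▸ hqA))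
    have hpa := hp.1
    have hqb := hq.2
    have hm := hmid p q hpA hqA (by linarith) (by linarith)
    rcases le_total ((p + q) / 2) t with h | h
    · have := hpmax ⟨hm, by linarith, h⟩
      linarith
    · have := hqmin ⟨hm, h, by linarith⟩
      linarith
  have hα' : α + Real.pi ∈ A := by simpa using (hper α 1).2 hα
  refine Set.eq_univ_of_forall fun t => ?_
  obtain ⟨k, hk, -⟩ := existsUnique_add_zsmul_mem_Ico Real.pi_pos t α
  rw [zsmul_eq_mul] at hk
  rw [← hper t k]
  rcases le_total (t + k * Real.pi) β with h | h
  · exact hIcc α β hα hβ hαβ hβα ⟨hk.1, h⟩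
  · exact hIcc β (α + Real.pi) hβ hα' hβα (by linarith) ⟨h, hk.2.le⟩

section

variable {X : Type*} [NormedAddCommGroup X] [NormedSpace ℝ X]

/-- Among the real-linear maps `T` with `‖T z‖ ≤ ‖L z‖` there is one of maximal determinant, and
this determinant is positive when `L` is injective. -/
theorem exists_isMaxOn_det (L : ℂ →L[ℝ] X) (hL : Function.Injective L) :
    ∃ T : ℂ →L[ℝ] ℂ, (∀ z, ‖T z‖ ≤ ‖L z‖) ∧ 0 < T.det ∧
      ∀ S : ℂ →L[ℝ] ℂ, (∀ z, ‖S z‖ ≤ ‖L z‖) → S.det ≤ T.det := by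
  have : ProperSpace (ℂ →L[ℝ] ℂ) := FiniteDimensional.proper_real _
  set K : Set (ℂ →L[ℝ] ℂ) := {T | ∀ z, ‖T z‖ ≤ ‖L z‖}
  have hKc : IsCompact K := by
    refine (isCompact_closedBall (0 : ℂ →L[ℝ] ℂ) ‖L‖).of_isClosed_subset ?_ ?_
    · simp only [K, Set.ofPred_forall]
      exact isClosed_iInter fun z => isClosed_le (by fun_prop) continuous_const
    · intro T hT
      rw [mem_closedBall_zero_iff]
      exact T.opNorm_le_bound (norm_nonneg _) fun z => (hT z).trans (L.le_opNorm z)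
  obtain ⟨T, hTK, hT⟩ := hKc.exists_isMaxOn ⟨0, fun z => by simp⟩
    (ContinuousLinearMap.continuous_det (E := ℂ) (𝕜 := ℝ)).continuousOn
  refine ⟨T, hTK, ?_, fun S hS => hT hS⟩
  obtain ⟨C, hC, hLC⟩ := (L : ℂ →ₗ[ℝ] X).exists_antilipschitzWith (LinearMap.ker_eq_bot.2 hL)
  have hC' : (0 : ℝ) < C := hC
  have hmem : ((C : ℝ)⁻¹ • ContinuousLinearMap.id ℝ ℂ) ∈ K := by
    intro z
    have h := hLC.le_mul_dist z 0
    simp only [dist_zero_right, map_zero] at h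
    have h' : ‖z‖ ≤ C * ‖L z‖ := h
    simp only [smul_apply, ContinuousLinearMap.id_apply, norm_smul, norm_inv,
      Real.norm_eq_abs, abs_of_pos hC']
    rwa [inv_mul_le_iff₀ hC']
  refine lt_of_lt_of_le ?_ (hT hmem)
  simp only [ContinuousLinearMap.det, ContinuousLinearMap.toLinearMap_smul, LinearMap.det_smul,
    ContinuousLinearMap.coe_id, LinearMap.det_id]
  positivity

/-- The real-linear map of `ℂ` scaling by `d₁` along the first axis and by `d₂` along the second,
after rotation by `conj u`. -/
noncomputable def axisScale (u : ℂ) (d₁ d₂ : ℝ) : ℂ →ₗ[ℝ] ℂ where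
  toFun z := ⟨d₁ * (u.re * z.re + u.im * z.im), d₂ * (u.re * z.im - u.im * z.re)⟩
  map_add' z w := by apply Complex.ext <;> simp <;> ring
  map_smul' r z := by apply Complex.ext <;> simp <;> ring

theorem det_axisScale (u : ℂ) (d₁ d₂ : ℝ) :
    LinearMap.det (axisScale u d₁ d₂) = d₁ * d₂ * (u.re ^ 2 + u.im ^ 2) := by
  rw [← LinearMap.det_toMatrix Complex.basisOneI, Matrix.det_fin_two]
  simp [LinearMap.toMatrix_apply, axisScale]
  ring

theorem norm_axisScale_sq (u z : ℂ) (d₁ d₂ : ℝ) :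
    ‖axisScale u d₁ d₂ z‖ ^ 2 = d₁ ^ 2 * (u.re * z.re + u.im * z.im) ^ 2 +
      d₂ ^ 2 * (u.re * z.im - u.im * z.re) ^ 2 := by
  rw [Complex.sq_norm, Complex.normSq_apply]
  simp [axisScale]
  ring

/-- If the Euclidean disc has minimal area among the ellipses containing the unit ball of
`z ↦ ‖M z‖`, then the contact points are not all on one line. -/
theorem exists_contact (M : ℂ →L[ℝ] X) (hM : ∀ z, ‖z‖ ≤ ‖M z‖)
    (hmax : ∀ D : ℂ →ₗ[ℝ] ℂ, (∀ z, ‖D z‖ ≤ ‖M z‖) → LinearMap.det D ≤ 1)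
    (u : ℂ) (hu : ‖u‖ = 1) :
    ∃ z : ℂ, ‖z‖ = 1 ∧ ‖M z‖ = 1 ∧ u.re * z.im - u.im * z.re ≠ 0 := by
  by_contra! hno
  have hu2 : u.re ^ 2 + u.im ^ 2 = 1 := by
    have := Complex.sq_norm u
    rw [Complex.normSq_apply, hu] at this
    linarith
  set W : Set ℂ := Metric.sphere 0 1 ∩ {z | 1 / 4 ≤ (u.re * z.im - u.im * z.re) ^ 2}
  have hWc : IsCompact W := (isCompact_sphere 0 1).inter_right
    (isClosed_le continuous_const (by fun_prop))
  have hWn : W.Nonempty := by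
    refine ⟨u * Complex.I, by simp [hu], ?_⟩
    have : u.re * (u * Complex.I).im - u.im * (u * Complex.I).re = 1 := by
      simp; linarith
    rw [Set.mem_ofPred_eq, this]; norm_num
  obtain ⟨w, ⟨hw1, hw2⟩, hwmin⟩ := hWc.exists_isMinOn hWn (f := fun z => ‖M z‖)
    (by fun_prop)
  rw [mem_sphere_zero_iff_norm] at hw1
  have hw : 1 < ‖M w‖ := by
    refine lt_of_le_of_ne (hw1 ▸ hM w) fun h => ?_
    have := hno w hw1 h.symm
    rw [Set.mem_ofPred_eq, this] at hw2
    norm_num at hw2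
  obtain ⟨b, hb0, hb1, hbw⟩ : ∃ b : ℝ, 0 < b ∧ b < 1 ∧ 1 + b ≤ ‖M w‖ ^ 2 := by
    refine ⟨min (1 / 2) (‖M w‖ - 1), lt_min (by norm_num) (by linarith),
      (min_le_left _ _).trans_lt (by norm_num), ?_⟩
    have := min_le_right (1 / 2) (‖M w‖ - 1)
    nlinarith
  have hunit : ∀ z : ℂ, ‖z‖ = 1 → ‖axisScale u √(1 - b / 2) √(1 + b) z‖ ≤ ‖M z‖ := by
    intro z hz
    refine le_of_sq_le_sq ?_ (norm_nonneg _)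
    rw [norm_axisScale_sq, Real.sq_sqrt (by linarith), Real.sq_sqrt (by linarith)]
    have hz2 : z.re ^ 2 + z.im ^ 2 = 1 := by
      have := Complex.sq_norm z
      rw [Complex.normSq_apply, hz] at this
      linarith
    have hsum : (u.re * z.re + u.im * z.im) ^ 2 + (u.re * z.im - u.im * z.re) ^ 2 = 1 := by
      calc _ = (u.re ^ 2 + u.im ^ 2) * (z.re ^ 2 + z.im ^ 2) := by ring
        _ = 1 := by rw [hu2, hz2, one_mul]
    set s := (u.re * z.im - u.im * z.re) ^ 2 with hs
    have hc : (u.re * z.re + u.im * z.im) ^ 2 = 1 - s := by linarith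
    have hs0 : 0 ≤ s := sq_nonneg _
    have hc0 : 0 ≤ 1 - s := hc ▸ sq_nonneg _
    rw [hc]
    rcases le_total (1 / 4) s with h | h
    · have h1 : ‖M w‖ ≤ ‖M z‖ := hwmin ⟨by simpa using hz, h⟩
      have h2 : ‖M w‖ ^ 2 ≤ ‖M z‖ ^ 2 := by gcongr
      nlinarith
    · have h1 := hM z
      rw [hz] at h1
      nlinarith
  have hdet := hmax (axisScale u √(1 - b / 2) √(1 + b)) fun z => by
    rcases eq_or_ne z 0 with rfl | hz
    · simp
    · have hz' : 0 < ‖z‖ := norm_pos_iff.2 hz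
      have h := hunit ((‖z‖⁻¹ : ℝ) • z) (by
        rw [norm_smul, norm_inv, norm_norm, inv_mul_cancel₀ hz'.ne'])
      rw [map_smul, map_smul, norm_smul, norm_smul] at h
      exact le_of_mul_le_mul_left h (by simpa using hz)
  rw [det_axisScale, hu2, mul_one, ← Real.sqrt_mul (by linarith), Real.sqrt_le_iff] at hdet
  nlinarith

/-- A plane in which `‖x + y‖² + ‖x - y‖² ≤ 4` for unit vectors is isometric to `ℂ`, as soon as the
Euclidean disc is the minimal ellipse containing the unit ball. -/
theorem norm_eq_of_rhombus_le
    (h : ∀ x y : X, ‖x‖ = 1 → ‖y‖ = 1 → ‖x + y‖ ^ 2 + ‖x - y‖ ^ 2 ≤ 4)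
    (M : ℂ →L[ℝ] X) (hM : ∀ z, ‖z‖ ≤ ‖M z‖)
    (hmax : ∀ D : ℂ →ₗ[ℝ] ℂ, (∀ z, ‖D z‖ ≤ ‖M z‖) → LinearMap.det D ≤ 1) (z : ℂ) :
    ‖M z‖ = ‖z‖ := by
  set e : ℝ → ℂ := fun t => ⟨Real.cos t, Real.sin t⟩ with he
  have hee : ∀ t, e t = Complex.exp (t * Complex.I) := fun t => by
    apply Complex.ext <;> simp [he, Complex.exp_ofReal_mul_I_re, Complex.exp_ofReal_mul_I_im]
  have hec : Continuous e := by
    have : e = fun t : ℝ => Complex.exp (t * Complex.I) := funext hee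
    rw [this]; fun_prop
  have hen : ∀ t, ‖e t‖ = 1 := fun t => by rw [hee, Complex.norm_exp_ofReal_mul_I]
  have hpolar : ∀ z : ℂ, z = ‖z‖ • e z.arg := fun z => by
    rw [hee, Complex.real_smul, Complex.norm_mul_exp_arg_mul_I]
  set A : Set ℝ := {t | ‖M (e t)‖ = 1} with hA
  have hAcl : IsClosed A := isClosed_eq (by fun_prop) continuous_const
  have hper : ∀ t (k : ℤ), t + k * Real.pi ∈ A ↔ t ∈ A := by
    intro t k
    have : e (t + k * Real.pi) = ((-1 : ℝ) ^ k) • e t := by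
      apply Complex.ext
      · simp only [he, Complex.smul_re, Real.cos_add_int_mul_pi, smul_eq_mul]
      · simp only [he, Complex.smul_im, Real.sin_add_int_mul_pi, smul_eq_mul]
    simp only [hA, Set.mem_ofPred_eq]
    rw [this, map_smul, norm_smul, norm_zpow]
    simp
  have hmid : ∀ s t, s ∈ A → t ∈ A → s < t → t < s + Real.pi → (s + t) / 2 ∈ A := by
    intro s t hs ht hst hts
    have hadd : e s + e t = (2 * Real.cos ((s - t) / 2)) • e ((s + t) / 2) := by
      apply Complex.ext
      · simp only [he, Complex.smul_re, Complex.add_re, Real.cos_add_cos, smul_eq_mul]; ring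
      · simp only [he, Complex.smul_im, Complex.add_im, Real.sin_add_sin, smul_eq_mul]; ring
    have hcos : 0 < Real.cos ((s - t) / 2) :=
      Real.cos_pos_of_mem_Ioo ⟨by linarith, by linarith⟩
    have h1 := h (M (e s)) (M (e t)) hs ht
    rw [← map_add, ← map_sub] at h1
    have h2 : ‖e s + e t‖ ^ 2 + ‖e s - e t‖ ^ 2 = 4 := by
      have := parallelogram_law_with_norm ℝ (e s) (e t)
      rw [hen, hen] at this
      linarith
    have h3 := hM (e s + e t)
    have h4 : ‖e s - e t‖ ^ 2 ≤ ‖M (e s - e t)‖ ^ 2 := by gcongr; exact hM _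
    have h5 : ‖M (e s + e t)‖ ≤ ‖e s + e t‖ := by
      refine le_of_sq_le_sq ?_ (norm_nonneg _)
      linarith
    have h6 := le_antisymm h5 h3
    rw [hadd, map_smul, norm_smul, norm_smul, hen] at h6
    exact mul_left_cancel₀ (norm_ne_zero_iff.2 (by positivity)) h6
  obtain ⟨p, hp1, hp2, -⟩ := exists_contact M hM hmax 1 (by simp)
  obtain ⟨q, hq1, hq2, hpq⟩ := exists_contact M hM hmax p hp1
  have hpA : p.arg ∈ A := by
    have := hpolar p
    rw [hp1, one_smul] at this
    rwa [hA, Set.mem_ofPred_eq, ← this]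
  have hqA : q.arg ∈ A := by
    have := hpolar q
    rw [hq1, one_smul] at this
    rwa [hA, Set.mem_ofPred_eq, ← this]
  obtain ⟨k, hk, -⟩ := existsUnique_add_zsmul_mem_Ico Real.pi_pos q.arg p.arg
  rw [zsmul_eq_mul] at hk
  have hne : q.arg + k * Real.pi ≠ p.arg := by
    intro hpk
    apply hpq
    have h1 := hpolar p
    have h2 := hpolar q
    rw [hp1, one_smul] at h1
    rw [hq1, one_smul] at h2
    rw [← hpk] at h1
    have hp_re : p.re = (-1) ^ k * q.re := by
      rw [congrArg Complex.re h1, congrArg Complex.re h2]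
      exact Real.cos_add_int_mul_pi _ _
    have hp_im : p.im = (-1) ^ k * q.im := by
      rw [congrArg Complex.im h1, congrArg Complex.im h2]
      exact Real.sin_add_int_mul_pi _ _
    rw [hp_re, hp_im]
    ring
  have huniv := eq_univ_of_isClosed_of_midpoint hAcl hper hmid hpA ((hper _ k).2 hqA)
    (lt_of_le_of_ne hk.1 hne.symm) hk.2
  have hz : z.arg ∈ A := huniv ▸ Set.mem_univ _
  have hz' : ‖M (e z.arg)‖ = 1 := hz
  conv_lhs => rw [hpolar z]
  rw [map_smul, norm_smul, hz', norm_norm, mul_one]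

/-- **Day's theorem**: if `‖x + y‖² + ‖x - y‖² ≤ 4` for all unit vectors, then the parallelogram law
holds. -/
theorem parallelogram_of_rhombus_le
    (h : ∀ x y : X, ‖x‖ = 1 → ‖y‖ = 1 → ‖x + y‖ ^ 2 + ‖x - y‖ ^ 2 ≤ 4) (x y : X) :
    ‖x + y‖ ^ 2 + ‖x - y‖ ^ 2 = 2 * ‖x‖ ^ 2 + 2 * ‖y‖ ^ 2 := by
  by_cases hxy : LinearIndependent ℝ ![x, y]
  · set L : ℂ →L[ℝ] X := Complex.reCLM.smulRight x + Complex.imCLM.smulRight y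
    have hLa : ∀ z, L z = z.re • x + z.im • y := fun z => by simp [L]
    have hL : Function.Injective L := by
      refine (injective_iff_map_eq_zero L).2 fun z hz => ?_
      rw [hLa] at hz
      obtain ⟨h1, h2⟩ := LinearIndependent.pair_iff.1 hxy _ _ hz
      exact Complex.ext h1 h2
    obtain ⟨T, hT, hT0, hTmax⟩ := exists_isMaxOn_det L hL
    set E : ℂ ≃ₗ[ℝ] ℂ := LinearMap.equivOfDetNeZero (T : ℂ →ₗ[ℝ] ℂ) hT0.ne'
    have hE : ∀ z, E z = T z := fun z => rfl
    set M : ℂ →L[ℝ] X := L.comp (LinearMap.toContinuousLinearMap (E.symm : ℂ →ₗ[ℝ] ℂ))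
    have hME : ∀ z, M (T z) = L z := fun z => by
      change L (E.symm (T z)) = L z
      rw [← hE, E.symm_apply_apply]
    have hsurj : ∀ w, ∃ z, T z = w := fun w => ⟨E.symm w, by rw [← hE, E.apply_symm_apply]⟩
    have hMnorm : ∀ z, ‖M z‖ = ‖z‖ := by
      refine norm_eq_of_rhombus_le h M (fun w => ?_) fun D hD => ?_
      · obtain ⟨z, rfl⟩ := hsurj w
        rw [hME]
        exact hT z
      · have := hTmax ((LinearMap.toContinuousLinearMap D).comp T) fun z => by
          simpa [hME] using hD (T z)
        have hcomp : ((LinearMap.toContinuousLinearMap D).comp T).det =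
            LinearMap.det D * T.det := by
          simp only [ContinuousLinearMap.det]
          rw [← LinearMap.det_comp]
          rfl
        rw [hcomp] at this
        exact le_of_mul_le_mul_right (by rwa [one_mul]) hT0
    have hx : M (T 1) = x := by rw [hME, hLa]; simp
    have hy : M (T Complex.I) = y := by rw [hME, hLa]; simp
    rw [← hx, ← hy, ← map_add, ← map_sub]
    simp only [hMnorm]
    have := parallelogram_law_with_norm ℝ (T 1) (T Complex.I)
    linarith
  · have hline : ∀ (v : X) (a b : ℝ), ‖a • v + b • v‖ ^ 2 + ‖a • v - b • v‖ ^ 2 =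
        2 * ‖a • v‖ ^ 2 + 2 * ‖b • v‖ ^ 2 := by
      intro v a b
      rw [← add_smul, ← sub_smul]
      simp only [norm_smul, mul_pow, Real.norm_eq_abs, sq_abs]
      ring
    rcases eq_or_ne x 0 with rfl | hx
    · simpa using hline y 0 1
    · rw [LinearIndependent.pair_iff' hx] at hxy
      push Not at hxy
      obtain ⟨a, rfl⟩ := hxy
      simpa using hline x 1 a

end

theorem bddAbove_SP_set (X : Type*) [NormedAddCommGroup X] [NormedSpace ℝ X] :
    BddAbove {r : ℝ | ∃ x y : X, ‖x‖ = 1 ∧ ‖y‖ = 1 ∧ x ≠ y ∧ x ≠ -y ∧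
      r = (‖x + y‖ ^ 2 + ‖x - y‖ ^ 2 - 4) / (2 * ‖x + y‖ * ‖x - y‖)} := by
  refine ⟨1, ?_⟩
  rintro r ⟨x, y, hx, hy, hxy, hxy', rfl⟩
  have ha : 0 < ‖x + y‖ := norm_pos_iff.2 fun h => hxy' (eq_neg_of_add_eq_zero_left h)
  have hb : 0 < ‖x - y‖ := norm_pos_iff.2 (sub_ne_zero.2 hxy)
  have ha2 : ‖x + y‖ ≤ 2 := (norm_add_le x y).trans (by rw [hx, hy]; norm_num)
  have hb2 : ‖x - y‖ ≤ 2 := (norm_sub_le x y).trans (by rw [hx, hy]; norm_num)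
  rw [div_le_one (by positivity)]
  rcases le_total ‖x + y‖ ‖x - y‖ with h | h <;> nlinarith

theorem stmt_3 (X : Type*) [NormedAddCommGroup X] [NormedSpace ℝ X] [CompleteSpace X]
    (hdim : 2 ≤ Module.rank ℝ X) :
    (∀ x y : X, ‖x + y‖ ^ 2 + ‖x - y‖ ^ 2 = 2 * ‖x‖ ^ 2 + 2 * ‖y‖ ^ 2) ↔ SP X = 0 := by
  constructor
  · intro h
    have h0 : ∀ r ∈ {r : ℝ | ∃ x y : X, ‖x‖ = 1 ∧ ‖y‖ = 1 ∧ x ≠ y ∧ x ≠ -y ∧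
        r = (‖x + y‖ ^ 2 + ‖x - y‖ ^ 2 - 4) / (2 * ‖x + y‖ * ‖x - y‖)}, r = 0 := by
      rintro r ⟨x, y, hx, hy, -, -, rfl⟩
      rw [h x y, hx, hy]
      norm_num
    exact le_antisymm (Real.sSup_nonpos fun r hr => (h0 r hr).le)
      (Real.sSup_nonneg fun r hr => (h0 r hr).ge)
  · intro h
    refine parallelogram_of_rhombus_le fun x y hx hy => ?_
    by_cases hxy : x = y
    · subst hxy
      rw [← two_smul ℝ x, norm_smul, hx]
      norm_num
    by_cases hxy' : x = -y
    · subst hxy'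
      rw [neg_add_cancel, ← neg_add', ← two_smul ℝ y, norm_neg, norm_smul, hy]
      norm_num
    have ha : 0 < ‖x + y‖ := norm_pos_iff.2 fun h => hxy' (eq_neg_of_add_eq_zero_left h)
    have hb : 0 < ‖x - y‖ := norm_pos_iff.2 (sub_ne_zero.2 hxy)
    have hle := le_csSup (bddAbove_SP_set X) ⟨x, y, hx, hy, hxy, hxy', rfl⟩
    change _ ≤ SP X at hle
    rw [h] at hle
    by_contra! hlt
    exact absurd hle (not_le.2 (div_pos (by linarith) (by positivity)))
end

section
/- Let X be a real Banach space of dimension at least 2. Then S_P(X) ≥ (C'_NJ(X) − 1)/2. -/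
/-- The modified von Neumann–Jordan constant `C'_NJ(X)`. -/
noncomputable def CNJ' (X : Type*) [NormedAddCommGroup X] [NormedSpace ℝ X] : ℝ :=
  sSup {r : ℝ | ∃ x y : X, ‖x‖ = 1 ∧ ‖y‖ = 1 ∧
    r = (‖x + y‖ ^ 2 + ‖x - y‖ ^ 2) / 4}

theorem norm_sub_le_two {X : Type*} [SeminormedAddCommGroup X] {x y : X} (hx : ‖x‖ = 1)
    (hy : ‖y‖ = 1) : ‖x - y‖ ≤ 2 := by
  have := norm_sub_le x y
  linarith

theorem norm_add_le_two {X : Type*} [SeminormedAddCommGroup X] {x y : X} (hx : ‖x‖ = 1)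
    (hy : ‖y‖ = 1) : ‖x + y‖ ≤ 2 := by
  have := norm_add_le x y
  linarith

section

variable {X : Type*} [NormedAddCommGroup X] [NormedSpace ℝ X]

/-- The values defining `SP X` are bounded above (by `1 / 2`), so each is at most `SP X`. -/
theorem le_SP {x y : X} (hx : ‖x‖ = 1) (hy : ‖y‖ = 1) (hne : x ≠ y) (hne' : x ≠ -y) :
    (‖x + y‖ ^ 2 + ‖x - y‖ ^ 2 - 4) / (2 * ‖x + y‖ * ‖x - y‖) ≤ SP X := by
  refine le_csSup ⟨1 / 2, ?_⟩ ⟨x, y, hx, hy, hne, hne', rfl⟩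
  rintro r ⟨u, v, hu, hv, huv, huv', rfl⟩
  have ha : 0 < ‖u + v‖ := norm_pos_iff.2 fun h => huv' (eq_neg_of_add_eq_zero_left h)
  have hb : 0 < ‖u - v‖ := norm_pos_iff.2 (sub_ne_zero.2 huv)
  have ha2 := norm_add_le_two hu hv
  have hb2 := norm_sub_le_two hu hv
  rw [div_le_iff₀ (by positivity)]
  rcases le_total ‖u + v‖ ‖u - v‖ with h | h <;> nlinarith

/-- In dimension at least two there are isosceles orthogonal unit vectors. -/
theorem exists_unit_norm_add_eq_norm_sub (hdim : 2 ≤ Module.rank ℝ X) :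
    ∃ x y : X, ‖x‖ = 1 ∧ ‖y‖ = 1 ∧ ‖x + y‖ = ‖x - y‖ := by
  have hrank : 1 < Module.rank ℝ X := lt_of_lt_of_le (by norm_num) hdim
  have hconn := isPreconnected_sphere hrank (0 : X) 1
  have : Nontrivial X := rank_pos_iff_nontrivial.1 (zero_lt_one.trans hrank)
  obtain ⟨x, hx⟩ := exists_norm_eq X zero_le_one
  obtain ⟨y, hy, h⟩ := hconn.intermediate_value₂ (a := -x) (b := x)
    (f := fun y => ‖x + y‖) (g := fun y => ‖x - y‖) (by simpa using hx) (by simpa using hx)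
    (by fun_prop) (by fun_prop) (by simp) (by simp)
  exact ⟨x, y, hx, by simpa using hy, h⟩

theorem SP_nonneg (hdim : 2 ≤ Module.rank ℝ X) : 0 ≤ SP X := by
  suffices h : ∃ x y : X, ‖x‖ = 1 ∧ ‖y‖ = 1 ∧ x ≠ y ∧ x ≠ -y ∧
      4 ≤ ‖x + y‖ ^ 2 + ‖x - y‖ ^ 2 by
    obtain ⟨x, y, hx, hy, hne, hne', h⟩ := h
    exact (div_nonneg (by linarith) (by positivity)).trans (le_SP hx hy hne hne')
  obtain ⟨x, y, hx, hy, h⟩ := exists_unit_norm_add_eq_norm_sub hdim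
  have hx2 : (x + y) + (x - y) = (2 : ℝ) • x := by module
  have hy2 : (x + y) - (x - y) = (2 : ℝ) • y := by module
  have ha : 0 < ‖x + y‖ := by
    have := norm_add_le (x + y) (x - y)
    rw [hx2, norm_smul, hx, Real.norm_ofNat] at this
    linarith
  set a := ‖x + y‖ with hadef
  by_cases h2 : 2 ≤ a ^ 2
  · refine ⟨x, y, hx, hy, ?_, ?_, by rw [← h]; linarith⟩
    · exact sub_ne_zero.1 (norm_pos_iff.1 (h ▸ ha))
    · rintro rfl
      simp [a] at ha
  · have hadd : ‖a⁻¹ • (x + y) + a⁻¹ • (x - y)‖ = 2 / a := by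
      rw [← smul_add, hx2, norm_smul, norm_smul, hx, Real.norm_ofNat,
        Real.norm_of_nonneg (by positivity)]
      ring
    have hsub : ‖a⁻¹ • (x + y) - a⁻¹ • (x - y)‖ = 2 / a := by
      rw [← smul_sub, hy2, norm_smul, norm_smul, hy, Real.norm_ofNat,
        Real.norm_of_nonneg (by positivity)]
      ring
    have hpos : 0 < 2 / a := by positivity
    refine ⟨a⁻¹ • (x + y), a⁻¹ • (x - y), ?_, ?_, ?_, ?_, ?_⟩
    · rw [norm_smul, Real.norm_of_nonneg (by positivity), ← hadef, inv_mul_cancel₀ ha.ne']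
    · rw [norm_smul, Real.norm_of_nonneg (by positivity), ← h, inv_mul_cancel₀ ha.ne']
    · exact sub_ne_zero.1 (norm_pos_iff.1 (hsub ▸ hpos))
    · intro h0
      rw [h0, neg_add_cancel, norm_zero] at hadd
      exact hpos.ne hadd
    · rw [hadd, hsub, div_pow, ← add_div, le_div_iff₀ (by positivity)]
      linarith

end

theorem stmt_4 (X : Type*) [NormedAddCommGroup X] [NormedSpace ℝ X] [CompleteSpace X]
    (hdim : 2 ≤ Module.rank ℝ X) :
    SP X ≥ (CNJ' X - 1) / 2 := by
  have h0 := SP_nonneg hdim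
  suffices h : CNJ' X ≤ 2 * SP X + 1 by linarith
  refine Real.sSup_le ?_ (by linarith)
  rintro r ⟨x, y, hx, hy, rfl⟩
  by_cases hc : ‖x + y‖ ^ 2 + ‖x - y‖ ^ 2 ≤ 4
  · linarith
  have ha2 := norm_add_le_two hx hy
  have hb2 := norm_sub_le_two hx hy
  have hne : x ≠ y := by
    rintro rfl
    exact hc (by rw [sub_self, norm_zero]; nlinarith [norm_nonneg (x + x)])
  have hne' : x ≠ -y := by
    rintro rfl
    exact hc (by rw [neg_add_cancel, norm_zero]; nlinarith [norm_nonneg (-y - y)])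
  have ha : 0 < ‖x + y‖ := norm_pos_iff.2 fun h => hne' (eq_neg_of_add_eq_zero_left h)
  have hb : 0 < ‖x - y‖ := norm_pos_iff.2 (sub_ne_zero.2 hne)
  have hle : (‖x + y‖ ^ 2 + ‖x - y‖ ^ 2 - 4) / 8 ≤
      (‖x + y‖ ^ 2 + ‖x - y‖ ^ 2 - 4) / (2 * ‖x + y‖ * ‖x - y‖) :=
    div_le_div_of_nonneg_left (by linarith) (by positivity) (by nlinarith)
  linarith [le_SP hx hy hne hne']
end

section
/- Let X be a real Banach space, let t ∈ (0, 1], and let x, y be unit vectors in X. Then ‖x+y‖² + ‖x−y‖² ≤ 2γ_X(t)/t². -/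
/-- The function `γ_X(t)`. -/
noncomputable def gammaX (X : Type*) [NormedAddCommGroup X] [NormedSpace ℝ X] (t : ℝ) : ℝ :=
  sSup {r : ℝ | ∃ x y : X, ‖x‖ = 1 ∧ ‖y‖ = 1 ∧
    r = (‖x + t • y‖ ^ 2 + ‖x - t • y‖ ^ 2) / 2}

theorem norm_smul_add_smul_le {X : Type*} [NormedAddCommGroup X] [NormedSpace ℝ X]
    {t : ℝ} (h0 : 0 ≤ t) (h1 : t ≤ 1) (x y : X) :
    t * ‖x + y‖ ≤ (1 + t) / 2 * ‖x + t • y‖ + (1 - t) / 2 * ‖x - t • y‖ := by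
  have key : t • (x + y) = ((1 + t) / 2) • (x + t • y) - ((1 - t) / 2) • (x - t • y) := by
    module
  calc t * ‖x + y‖ = ‖t • (x + y)‖ := by rw [norm_smul, Real.norm_of_nonneg h0]
    _ ≤ ‖((1 + t) / 2) • (x + t • y)‖ + ‖((1 - t) / 2) • (x - t • y)‖ := by
      rw [key]
      exact norm_sub_le _ _
    _ = _ := by
      rw [norm_smul, norm_smul, Real.norm_of_nonneg (by linarith),
        Real.norm_of_nonneg (by linarith)]

theorem le_gammaX {X : Type*} [NormedAddCommGroup X] [NormedSpace ℝ X]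
    (t : ℝ) {x y : X} (hx : ‖x‖ = 1) (hy : ‖y‖ = 1) :
    (‖x + t • y‖ ^ 2 + ‖x - t • y‖ ^ 2) / 2 ≤ gammaX X t := by
  refine le_csSup ⟨(1 + |t|) ^ 2, ?_⟩ ⟨x, y, hx, hy, rfl⟩
  rintro r ⟨u, v, hu, hv, rfl⟩
  have hadd : ‖u + t • v‖ ≤ 1 + |t| := by
    simpa [norm_smul, hu, hv] using norm_add_le u (t • v)
  have hsub : ‖u - t • v‖ ≤ 1 + |t| := by
    simpa [norm_smul, hu, hv] using norm_sub_le u (t • v)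
  have hadd_sq := pow_le_pow_left₀ (norm_nonneg _) hadd 2
  have hsub_sq := pow_le_pow_left₀ (norm_nonneg _) hsub 2
  linarith

theorem stmt_6 (X : Type*) [NormedAddCommGroup X] [NormedSpace ℝ X] [CompleteSpace X]
    (t : ℝ) (ht : t ∈ Set.Ioc (0 : ℝ) 1)
    (x y : X) (hx : ‖x‖ = 1) (hy : ‖y‖ = 1) :
    ‖x + y‖ ^ 2 + ‖x - y‖ ^ 2 ≤ 2 * gammaX X t / t ^ 2 := by
  obtain ⟨h0, h1⟩ := ht
  have hadd := norm_smul_add_smul_le h0.le h1 x y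
  have hsub := norm_smul_add_smul_le h0.le h1 x (-y)
  simp only [smul_neg, ← sub_eq_add_neg, sub_neg_eq_add] at hsub
  have hadd_sq := pow_le_pow_left₀ (by positivity) hadd 2
  have hsub_sq := pow_le_pow_left₀ (by positivity) hsub 2
  have hgamma := le_gammaX t hx hy
  rw [le_div_iff₀ (by positivity)]
  have hcross : 0 ≤ (1 - t ^ 2) * (‖x + t • y‖ - ‖x - t • y‖) ^ 2 :=
    mul_nonneg (by nlinarith) (sq_nonneg _)
  linarith
end

section
/- Let X be a real Banach space of dimension at least 1. Then the norm of X arises from an inner product (equivalently, X satisfies the parallelogram law ‖x+y‖² + ‖x−y‖² = 2‖x‖² + 2‖y‖² for all x, y ∈ X) if and only if C_Z(X) = 1. -/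
/-- The Zbaganu constant `C_Z(X)`. -/
noncomputable def CZ (X : Type*) [NormedAddCommGroup X] [NormedSpace ℝ X] : ℝ :=
  sSup {r : ℝ | ∃ x y : X, (x, y) ≠ (0, 0) ∧
    r = ‖x + y‖ * ‖x - y‖ / (‖x‖ ^ 2 + ‖y‖ ^ 2)}

/-- The ellipse with conjugate semi-diameters `p`, `q` lies in the closed unit ball. -/
def EllipseInBall {Y : Type*} [NormedAddCommGroup Y] [NormedSpace ℝ Y] (p q : Y) : Prop :=
  ∀ s t : ℝ, ‖s • p + t • q‖ ^ 2 ≤ s ^ 2 + t ^ 2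

section Ellipse

variable {Y : Type*} [NormedAddCommGroup Y] [NormedSpace ℝ Y]

theorem EllipseInBall.rotate {p q : Y} (h : EllipseInBall p q) {s t : ℝ} (hst : s ^ 2 + t ^ 2 = 1) :
    EllipseInBall (s • p + t • q) (-t • p + s • q) := by
  intro a b
  have h1 := h (a * s - b * t) (a * t + b * s)
  have e : a • (s • p + t • q) + b • (-t • p + s • q)
      = (a * s - b * t) • p + (a * t + b * s) • q := by module
  rw [e]
  have e2 : (a * s - b * t) ^ 2 + (a * t + b * s) ^ 2 = (a ^ 2 + b ^ 2) * (s ^ 2 + t ^ 2) := by ring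
  rw [e2, hst, mul_one] at h1
  exact h1

theorem norm_sq_le_of_norm_sq_le_on_circle {p q : Y} {M s t : ℝ} (hst : s ^ 2 ≤ t ^ 2)
    (hM : ∀ s t : ℝ, s ^ 2 + t ^ 2 = 1 → s ^ 2 ≤ t ^ 2 → ‖s • p + t • q‖ ^ 2 ≤ M) :
    ‖s • p + t • q‖ ^ 2 ≤ M * (s ^ 2 + t ^ 2) := by
  rcases eq_or_ne (s ^ 2 + t ^ 2) 0 with h0 | h0
  · have hs : s = 0 := by nlinarith [sq_nonneg s, sq_nonneg t]
    have ht : t = 0 := by nlinarith [sq_nonneg s, sq_nonneg t]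
    simp [hs, ht]
  · have hpos : 0 < s ^ 2 + t ^ 2 := lt_of_le_of_ne (by positivity) h0.symm
    set r := √(s ^ 2 + t ^ 2) with hr
    have hr0 : 0 < r := Real.sqrt_pos.2 hpos
    have hr2 : r ^ 2 = s ^ 2 + t ^ 2 := Real.sq_sqrt hpos.le
    have h1 := hM (s / r) (t / r) (by rw [div_pow, div_pow, ← add_div, hr2, div_self h0])
      (by rw [div_pow, div_pow]; gcongr)
    have e : s • p + t • q = r • ((s / r) • p + (t / r) • q) := by
      rw [smul_add, smul_smul, smul_smul, mul_div_cancel₀ _ hr0.ne', mul_div_cancel₀ _ hr0.ne']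
    rw [e, norm_smul, mul_pow, Real.norm_eq_abs, sq_abs, ← hr2, mul_comm M]
    gcongr

theorem EllipseInBall.exists_max [FiniteDimensional ℝ Y] (f g : Y →ₗ[ℝ] ℝ) :
    ∃ p q : Y, EllipseInBall p q ∧ ∀ p' q' : Y, EllipseInBall p' q' →
      f p' * g q' - f q' * g p' ≤ f p * g q - f q * g p := by
  have : ProperSpace Y := FiniteDimensional.proper ℝ Y
  have hf := f.continuous_of_finiteDimensional
  have hg := g.continuous_of_finiteDimensional
  have hK : IsCompact {z : Y × Y | EllipseInBall z.1 z.2} := by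
    refine (isCompact_closedBall (0 : Y × Y) 1).of_isClosed_subset ?_ ?_
    · simp only [EllipseInBall, Set.ofPred_forall]
      exact isClosed_iInter fun s => isClosed_iInter fun t =>
        isClosed_le (by fun_prop) (by fun_prop)
    · rintro ⟨p, q⟩ h
      have h1 := h 1 0
      have h2 := h 0 1
      simp only [one_smul, zero_smul, add_zero, zero_add] at h1 h2
      rw [mem_closedBall_zero_iff, Prod.norm_def]
      exact max_le (by nlinarith [norm_nonneg p]) (by nlinarith [norm_nonneg q])
  obtain ⟨z, hz, hmax⟩ := hK.exists_isMaxOn (f := fun z : Y × Y => f z.1 * g z.2 - f z.2 * g z.1)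
    ⟨(0, 0), fun s t => by simp; positivity⟩ (by fun_prop)
  exact ⟨z.1, z.2, hz, fun p' q' h => hmax (show (p', q') ∈ _ from h)⟩

theorem EllipseInBall.exists_contact {f g : Y →ₗ[ℝ] ℝ} {p q : Y} (h : EllipseInBall p q)
    (hpos : 0 < f p * g q - f q * g p)
    (hmax : ∀ p' q' : Y, EllipseInBall p' q' →
      f p' * g q' - f q' * g p' ≤ f p * g q - f q * g p) :
    ∃ s t : ℝ, s ^ 2 + t ^ 2 = 1 ∧ s ^ 2 ≤ t ^ 2 ∧ ‖s • p + t • q‖ = 1 := by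
  have hK : IsCompact {z : ℝ × ℝ | z.1 ^ 2 + z.2 ^ 2 = 1 ∧ z.1 ^ 2 ≤ z.2 ^ 2} := by
    refine (isCompact_closedBall (0 : ℝ × ℝ) 1).of_isClosed_subset ?_ ?_
    · have h1 : IsClosed {z : ℝ × ℝ | z.1 ^ 2 + z.2 ^ 2 = 1} :=
        isClosed_eq (by fun_prop) (by fun_prop)
      have h2 : IsClosed {z : ℝ × ℝ | z.1 ^ 2 ≤ z.2 ^ 2} :=
        isClosed_le (by fun_prop) (by fun_prop)
      exact h1.inter h2
    · rintro ⟨s, t⟩ ⟨h1, -⟩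
      rw [mem_closedBall_zero_iff, Prod.norm_def]
      exact max_le (abs_le_one_iff_mul_self_le_one.2 (by nlinarith [sq_nonneg t]))
        (abs_le_one_iff_mul_self_le_one.2 (by nlinarith [sq_nonneg s]))
  obtain ⟨⟨s, t⟩, ⟨hst, hle⟩, hM⟩ := hK.exists_isMaxOn
    (f := fun z : ℝ × ℝ => ‖z.1 • p + z.2 • q‖ ^ 2) ⟨(0, 1), by simp⟩ (by fun_prop)
  refine ⟨s, t, hst, hle, ?_⟩
  dsimp only at hst hle
  have hM' : ∀ a b : ℝ, a ^ 2 + b ^ 2 = 1 → a ^ 2 ≤ b ^ 2 →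
      ‖a • p + b • q‖ ^ 2 ≤ ‖s • p + t • q‖ ^ 2 := fun a b h1 h2 =>
    hM (show (a, b) ∈ {z : ℝ × ℝ | z.1 ^ 2 + z.2 ^ 2 = 1 ∧ z.1 ^ 2 ≤ z.2 ^ 2} from ⟨h1, h2⟩)
  have hle1 := h s t
  rw [hst] at hle1
  by_contra hne
  have hlt : ‖s • p + t • q‖ ^ 2 < 1 := lt_of_le_of_ne hle1 fun h1 =>
    hne (by nlinarith [norm_nonneg (s • p + t • q)])
  obtain ⟨ε, hε⟩ : ∃ ε, ε = (1 - ‖s • p + t • q‖ ^ 2) / 2 := ⟨_, rfl⟩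
  have hε0 : 0 < ε := by linarith
  have hε1 : ε < 1 := by nlinarith [sq_nonneg ‖s • p + t • q‖]
  have hB : ∀ a b : ℝ, ‖a • p + b • q‖ ^ 2 ≤ (1 + ε) * a ^ 2 + (1 - ε) * b ^ 2 := by
    intro a b
    rcases le_total (a ^ 2) (b ^ 2) with hab | hab
    · have := norm_sq_le_of_norm_sq_le_on_circle hab hM'
      have h3 : ‖s • p + t • q‖ ^ 2 = 1 - 2 * ε := by linarith
      rw [h3] at this
      nlinarith [sq_nonneg a, sq_nonneg b]
    · nlinarith [h a b]
  have hr : 0 < √(1 + ε) := Real.sqrt_pos.2 (by linarith)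
  have hρ : 0 < √(1 - ε) := Real.sqrt_pos.2 (by linarith)
  have hr2 : √(1 + ε) ^ 2 = 1 + ε := Real.sq_sqrt (by linarith)
  have hρ2 : √(1 - ε) ^ 2 = 1 - ε := Real.sq_sqrt (by linarith)
  generalize √(1 + ε) = r at *
  generalize √(1 - ε) = ρ at *
  have hrρ : r * ρ < 1 := by
    have : (r * ρ) ^ 2 < 1 := by rw [mul_pow, hr2, hρ2]; nlinarith
    nlinarith [mul_pos hr hρ]
  have hnew := hmax (r⁻¹ • p) (ρ⁻¹ • q) (by
    intro a b
    have := hB (a * r⁻¹) (b * ρ⁻¹)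
    rw [← hr2, ← hρ2, ← mul_pow, ← mul_pow, mul_left_comm r, mul_left_comm ρ,
      mul_inv_cancel₀ hr.ne', mul_inv_cancel₀ hρ.ne', mul_one, mul_one] at this
    rwa [smul_smul, smul_smul])
  simp only [map_smul, smul_eq_mul] at hnew
  have e : r⁻¹ * f p * (ρ⁻¹ * g q) - ρ⁻¹ * f q * (r⁻¹ * g p)
      = (f p * g q - f q * g p) / (r * ρ) := by field_simp
  rw [e, div_le_iff₀ (mul_pos hr hρ)] at hnew
  nlinarith

theorem IsClosed.Icc_subset_of_midpoint {T : Set ℝ} (hT : IsClosed T) {a b : ℝ} (ha : a ∈ T)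
    (hb : b ∈ T)
    (hmid : ∀ x ∈ T, ∀ y ∈ T, a ≤ x → x ≤ y → y ≤ b → (x + y) / 2 ∈ T) :
    Set.Icc a b ⊆ T := by
  rintro θ ⟨h1, h2⟩
  have hA : IsCompact (T ∩ Set.Icc a θ) := isCompact_Icc.inter_left hT
  have hB : IsCompact (T ∩ Set.Icc θ b) := isCompact_Icc.inter_left hT
  obtain ⟨x, ⟨hxT, hx⟩, hxmax⟩ := hA.exists_isGreatest ⟨a, ha, le_rfl, h1⟩
  obtain ⟨y, ⟨hyT, hy⟩, hymin⟩ := hB.exists_isLeast ⟨b, hb, h2, le_rfl⟩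
  have hm := hmid x hxT y hyT hx.1 (hx.2.trans hy.1) hy.2
  obtain ⟨hx1, hx2⟩ := hx
  obtain ⟨hy1, hy2⟩ := hy
  rcases le_total ((x + y) / 2) θ with h | h
  · have := hxmax ⟨hm, by linarith, h⟩
    have : x = θ := by linarith
    exact this ▸ hxT
  · have := hymin ⟨hm, h, by linarith⟩
    have : y = θ := by linarith
    exact this ▸ hyT

theorem EllipseInBall.contact_midpoint {p q : Y} (h : EllipseInBall p q)
    (H : ∀ u v : Y, 4 * (‖u‖ * ‖v‖) ≤ ‖u + v‖ ^ 2 + ‖u - v‖ ^ 2) {a b : ℝ}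
    (hcos : Real.cos ((a - b) / 2) ≠ 0)
    (ha : ‖Real.cos a • p + Real.sin a • q‖ = 1) (hb : ‖Real.cos b • p + Real.sin b • q‖ = 1) :
    ‖Real.cos ((a + b) / 2) • p + Real.sin ((a + b) / 2) • q‖ = 1 := by
  have h1 := H (Real.cos a • p + Real.sin a • q) (Real.cos b • p + Real.sin b • q)
  have e1 : Real.cos a • p + Real.sin a • q + (Real.cos b • p + Real.sin b • q)
      = (2 * Real.cos ((a - b) / 2)) •
        (Real.cos ((a + b) / 2) • p + Real.sin ((a + b) / 2) • q) := by
    have e : Real.cos a • p + Real.sin a • q + (Real.cos b • p + Real.sin b • q)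
      = (Real.cos a + Real.cos b) • p + (Real.sin a + Real.sin b) • q := by module
    rw [e, Real.cos_add_cos, Real.sin_add_sin]
    module
  have e2 : Real.cos a • p + Real.sin a • q - (Real.cos b • p + Real.sin b • q)
      = (Real.cos a - Real.cos b) • p + (Real.sin a - Real.sin b) • q := by module
  have h2 := h (Real.cos a - Real.cos b) (Real.sin a - Real.sin b)
  rw [ha, hb, e1, e2, norm_smul, mul_pow, Real.norm_eq_abs, sq_abs] at h1
  have h3 : (Real.cos a - Real.cos b) ^ 2 + (Real.sin a - Real.sin b) ^ 2
      = 4 - 4 * Real.cos ((a - b) / 2) ^ 2 := by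
    rw [Real.cos_sub_cos, Real.sin_sub_sin]
    linear_combination (4 * Real.sin ((a - b) / 2) ^ 2) * Real.sin_sq_add_cos_sq ((a + b) / 2)
      + 4 * Real.sin_sq_add_cos_sq ((a - b) / 2)
  have h4 := h (Real.cos ((a + b) / 2)) (Real.sin ((a + b) / 2))
  rw [Real.cos_sq_add_sin_sq] at h4
  have hc : 0 < Real.cos ((a - b) / 2) ^ 2 := by positivity
  set n := ‖Real.cos ((a + b) / 2) • p + Real.sin ((a + b) / 2) • q‖
  have h5 : 1 ≤ n ^ 2 := by
    by_contra hlt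
    nlinarith
  have hn : 0 ≤ n := norm_nonneg _
  nlinarith

theorem cos_sin_arccos_of_sq_add_sq {s t : ℝ} (hst : s ^ 2 + t ^ 2 = 1) (ht : 0 ≤ t) :
    Real.cos (Real.arccos s) = s ∧ Real.sin (Real.arccos s) = t := by
  refine ⟨Real.cos_arccos (by nlinarith [sq_nonneg t]) (by nlinarith [sq_nonneg t]), ?_⟩
  rw [Real.sin_arccos, show 1 - s ^ 2 = t ^ 2 by linarith, Real.sqrt_sq ht]

theorem norm_neg_smul_add_neg_smul (p q : Y) (s t : ℝ) :
    ‖(-s) • p + (-t) • q‖ = ‖s • p + t • q‖ := by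
  rw [← norm_neg]
  congr 1
  module

theorem EllipseInBall.norm_sq_eq {p q : Y} (h : EllipseInBall p q)
    (H : ∀ u v : Y, 4 * (‖u‖ * ‖v‖) ≤ ‖u + v‖ ^ 2 + ‖u - v‖ ^ 2) (hp : ‖p‖ = 1) {s t : ℝ}
    (hst : s ^ 2 + t ^ 2 = 1) (ht : 0 < t) (hc : ‖s • p + t • q‖ = 1) (a b : ℝ) :
    ‖a • p + b • q‖ ^ 2 = a ^ 2 + b ^ 2 := by
  let T : Set ℝ := {θ | ‖Real.cos θ • p + Real.sin θ • q‖ = 1}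
  have hT : IsClosed T := isClosed_eq (by fun_prop) (by fun_prop)
  have hIcc : ∀ x y : ℝ, x ∈ T → y ∈ T → y < x + Real.pi → Set.Icc x y ⊆ T := by
    intro x y hx hy hxy
    refine hT.Icc_subset_of_midpoint hx hy fun u hu v hv h1 h2 h3 => h.contact_midpoint H ?_ hu hv
    exact (Real.cos_pos_of_mem_Ioo ⟨by linarith, by linarith [Real.pi_pos]⟩).ne'
  obtain ⟨hcos, hsin⟩ := cos_sin_arccos_of_sq_add_sq hst ht.le
  have h0 : (0 : ℝ) ∈ T := by simp [T, hp]
  have hπ : Real.pi ∈ T := by simp [T, hp]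
  have hφ : Real.arccos s ∈ T := by simp only [T, Set.mem_ofPred_eq, hcos, hsin, hc]
  have hφ0 : 0 < Real.arccos s := Real.arccos_pos.2 (by nlinarith)
  have hφπ : Real.arccos s < Real.pi := by
    refine lt_of_le_of_ne (Real.arccos_le_pi s) fun he => ?_
    rw [he, Real.sin_pi] at hsin
    exact ht.ne hsin
  have hall : Set.Icc 0 Real.pi ⊆ T := by
    rintro θ ⟨h1, h2⟩
    rcases le_total θ (Real.arccos s) with h3 | h3
    · exact hIcc _ _ h0 hφ (by linarith) ⟨h1, h3⟩
    · exact hIcc _ _ hφ hπ (by linarith) ⟨h3, h2⟩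
  have hunit : ∀ a b : ℝ, a ^ 2 + b ^ 2 = 1 → 0 ≤ b → ‖a • p + b • q‖ = 1 := by
    intro a b hab hb
    obtain ⟨h1, h2⟩ := cos_sin_arccos_of_sq_add_sq hab hb
    have h3 : Real.arccos a ∈ T := hall ⟨Real.arccos_nonneg a, Real.arccos_le_pi a⟩
    simpa only [T, Set.mem_ofPred_eq, h1, h2] using h3
  have hunit' : ∀ a b : ℝ, a ^ 2 + b ^ 2 = 1 → ‖a • p + b • q‖ = 1 := by
    intro a b hab
    rcases le_total 0 b with hb | hb
    · exact hunit a b hab hb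
    · rw [← norm_neg_smul_add_neg_smul]
      exact hunit _ _ (by linarith [neg_sq a, neg_sq b]) (by linarith)
  rcases eq_or_ne (a ^ 2 + b ^ 2) 0 with h0 | h0
  · have ha : a = 0 := by nlinarith [sq_nonneg a, sq_nonneg b]
    have hb : b = 0 := by nlinarith [sq_nonneg a, sq_nonneg b]
    simp [ha, hb]
  · have hpos : 0 < a ^ 2 + b ^ 2 := lt_of_le_of_ne (by positivity) h0.symm
    have hr0 : 0 < √(a ^ 2 + b ^ 2) := Real.sqrt_pos.2 hpos
    have hr2 : √(a ^ 2 + b ^ 2) ^ 2 = a ^ 2 + b ^ 2 := Real.sq_sqrt hpos.le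
    generalize √(a ^ 2 + b ^ 2) = r at *
    have h1 := hunit' (a / r) (b / r) (by rw [div_pow, div_pow, ← add_div, hr2, div_self h0])
    have e : a • p + b • q = r • ((a / r) • p + (b / r) • q) := by
      rw [smul_add, smul_smul, smul_smul, mul_div_cancel₀ _ hr0.ne', mul_div_cancel₀ _ hr0.ne']
    rw [e, norm_smul, h1, mul_one, Real.norm_eq_abs, sq_abs, hr2]

/-- The rhombus theorem of Day in a plane. -/
theorem parallelogram_of_basis (B : Module.Basis (Fin 2) ℝ Y)
    (H : ∀ u v : Y, 4 * (‖u‖ * ‖v‖) ≤ ‖u + v‖ ^ 2 + ‖u - v‖ ^ 2) (x y : Y) :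
    ‖x + y‖ ^ 2 + ‖x - y‖ ^ 2 = 2 * ‖x‖ ^ 2 + 2 * ‖y‖ ^ 2 := by
  have : FiniteDimensional ℝ Y := B.finiteDimensional_of_finite
  set f := B.coord 0 with hf
  set g := B.coord 1 with hg
  have hfg : ∀ u v : Y, f u = f v → g u = g v → u = v := by
    intro u v h0 h1
    refine B.ext_elem fun i => ?_
    fin_cases i
    · exact h0
    · exact h1
  obtain ⟨p₀, q₀, h₀, hmax₀⟩ := EllipseInBall.exists_max f g
  have hpos₀ : 0 < f p₀ * g q₀ - f q₀ * g p₀ := by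
    obtain ⟨c, hc, hcB⟩ : ∃ c : ℝ, 0 < c ∧ EllipseInBall (c • B 0) (c • B 1) := by
      have hD : 0 < 1 + ‖B 0‖ + ‖B 1‖ := by positivity
      refine ⟨(1 + ‖B 0‖ + ‖B 1‖)⁻¹, inv_pos.2 hD, fun s t => ?_⟩
      have e : s • (1 + ‖B 0‖ + ‖B 1‖)⁻¹ • B 0 + t • (1 + ‖B 0‖ + ‖B 1‖)⁻¹ • B 1
          = (1 + ‖B 0‖ + ‖B 1‖)⁻¹ • (s • B 0 + t • B 1) := by module
      rw [e, norm_smul, mul_pow, Real.norm_eq_abs, sq_abs, inv_pow,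
        inv_mul_le_iff₀ (by positivity)]
      have h1 : ‖s • B 0 + t • B 1‖ ≤ |s| * ‖B 0‖ + |t| * ‖B 1‖ := by
        simpa [norm_smul] using norm_add_le (s • B 0) (t • B 1)
      have h2 : (|s| * ‖B 0‖ + |t| * ‖B 1‖) ^ 2 ≤
          (‖B 0‖ ^ 2 + ‖B 1‖ ^ 2) * (s ^ 2 + t ^ 2) := by
        rw [← sq_abs s, ← sq_abs t]
        nlinarith [sq_nonneg (|s| * ‖B 1‖ - |t| * ‖B 0‖)]
      calc ‖s • B 0 + t • B 1‖ ^ 2 ≤ (|s| * ‖B 0‖ + |t| * ‖B 1‖) ^ 2 := by gcongr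
        _ ≤ _ := h2
        _ ≤ _ := by
          gcongr
          nlinarith [norm_nonneg (B 0), norm_nonneg (B 1),
            mul_nonneg (norm_nonneg (B 0)) (norm_nonneg (B 1))]
    have := hmax₀ _ _ hcB
    simp [hf, hg] at this
    simp only [hf, hg, Module.Basis.coord_apply]
    nlinarith
  obtain ⟨s₀, t₀, hst₀, -, hc₀⟩ := h₀.exists_contact hpos₀ hmax₀
  have h := h₀.rotate hst₀
  have hdet : f (s₀ • p₀ + t₀ • q₀) * g (-t₀ • p₀ + s₀ • q₀)
      - f (-t₀ • p₀ + s₀ • q₀) * g (s₀ • p₀ + t₀ • q₀) = f p₀ * g q₀ - f q₀ * g p₀ := by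
    simp only [map_add, map_smul, smul_eq_mul]
    linear_combination (f p₀ * g q₀ - f q₀ * g p₀) * hst₀
  generalize s₀ • p₀ + t₀ • q₀ = p at *
  generalize -t₀ • p₀ + s₀ • q₀ = q at *
  rw [← hdet] at hpos₀ hmax₀
  obtain ⟨s, t, hst, hle, hc⟩ := h.exists_contact hpos₀ hmax₀
  have key : ∀ a b : ℝ, ‖a • p + b • q‖ ^ 2 = a ^ 2 + b ^ 2 := by
    rcases lt_trichotomy t 0 with ht | ht | ht
    · exact h.norm_sq_eq H hc₀ (s := -s) (t := -t) (by linarith [neg_sq s, neg_sq t])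
        (by linarith) (by rw [norm_neg_smul_add_neg_smul, hc])
    · subst ht
      nlinarith
    · exact h.norm_sq_eq H hc₀ hst ht hc
  have hspan : ∀ z : Y, ∃ a b : ℝ, z = a • p + b • q := by
    intro z
    have hne := hpos₀.ne'
    refine ⟨(f z * g q - f q * g z) / (f p * g q - f q * g p),
      (f p * g z - f z * g p) / (f p * g q - f q * g p), hfg _ _ ?_ ?_⟩ <;>
    · simp only [map_add, map_smul, smul_eq_mul]
      rw [div_mul_eq_mul_div, div_mul_eq_mul_div, ← add_div, eq_div_iff hne]
      ring
  obtain ⟨a, b, rfl⟩ := hspan x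
  obtain ⟨c, d, rfl⟩ := hspan y
  have e1 : a • p + b • q + (c • p + d • q) = (a + c) • p + (b + d) • q := by module
  have e2 : a • p + b • q - (c • p + d • q) = (a - c) • p + (b - d) • q := by module
  rw [e1, e2, key, key, key, key]
  ring

/-- The rhombus theorem of Day. -/
theorem parallelogram_of_four_mul_norm_mul_norm_le
    (H : ∀ u v : Y, 4 * (‖u‖ * ‖v‖) ≤ ‖u + v‖ ^ 2 + ‖u - v‖ ^ 2) (x y : Y) :
    ‖x + y‖ ^ 2 + ‖x - y‖ ^ 2 = 2 * ‖x‖ ^ 2 + 2 * ‖y‖ ^ 2 := by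
  by_cases hli : LinearIndependent ℝ ![x, y]
  · let S := Submodule.span ℝ (Set.range ![x, y])
    exact parallelogram_of_basis (Module.Basis.span hli) (fun u v : S => H u v)
      (⟨x, Submodule.subset_span ⟨0, rfl⟩⟩ : S) ⟨y, Submodule.subset_span ⟨1, rfl⟩⟩
  · rcases eq_or_ne x 0 with rfl | hx
    · simp
      ring
    · rw [LinearIndependent.pair_iff' hx] at hli
      push Not at hli
      obtain ⟨c, rfl⟩ := hli
      have e1 : x + c • x = (1 + c) • x := by module
      have e2 : x - c • x = (1 - c) • x := by module
      rw [e1, e2, norm_smul, norm_smul, norm_smul, mul_pow, mul_pow, mul_pow]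
      simp only [Real.norm_eq_abs, sq_abs]
      ring

end Ellipse

theorem stmt_7 (X : Type*) [NormedAddCommGroup X] [NormedSpace ℝ X] [CompleteSpace X]
    (hdim : 1 ≤ Module.rank ℝ X) :
    (∀ x y : X, ‖x + y‖ ^ 2 + ‖x - y‖ ^ 2 = 2 * ‖x‖ ^ 2 + 2 * ‖y‖ ^ 2) ↔ CZ X = 1 := by
  have hden : ∀ x y : X, (x, y) ≠ (0, 0) → 0 < ‖x‖ ^ 2 + ‖y‖ ^ 2 := by
    intro x y hxy
    rcases eq_or_ne x 0 with hx | hx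
    · have hy : y ≠ 0 := fun hy => hxy (by rw [hx, hy])
      have := norm_pos_iff.2 hy
      positivity
    · have := norm_pos_iff.2 hx
      positivity
  constructor
  · intro h
    have : Nontrivial X := rank_pos_iff_nontrivial.1 (zero_lt_one.trans_le hdim)
    obtain ⟨x, hx⟩ := exists_ne (0 : X)
    refine IsGreatest.csSup_eq ⟨⟨x, 0, by simp [hx], ?_⟩, ?_⟩
    · have := norm_ne_zero_iff.2 hx
      simp
      field_simp
    · rintro r ⟨x, y, hxy, rfl⟩
      rw [div_le_one (hden x y hxy)]
      nlinarith [h x y, sq_nonneg (‖x + y‖ - ‖x - y‖)]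
  · intro h
    refine parallelogram_of_four_mul_norm_mul_norm_le fun u v => ?_
    have hbdd : BddAbove {r : ℝ | ∃ x y : X, (x, y) ≠ (0, 0) ∧
        r = ‖x + y‖ * ‖x - y‖ / (‖x‖ ^ 2 + ‖y‖ ^ 2)} := by
      by_contra hb
      rw [CZ, Real.sSup_of_not_bddAbove hb] at h
      exact zero_ne_one h
    rcases eq_or_ne (u + v, u - v) (0, 0) with h0 | h0
    · obtain ⟨h1, h2⟩ := Prod.mk.inj h0
      have hu : u = 0 := by
        have : (2 : ℝ) • u = (u + v) + (u - v) := by module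
        rw [h1, h2, add_zero] at this
        simpa using this
      simp only [hu, norm_zero, zero_mul, mul_zero]
      positivity
    · have h1 := le_csSup hbdd ⟨u + v, u - v, h0, rfl⟩
      change _ ≤ CZ X at h1
      rw [h, div_le_one (hden _ _ h0)] at h1
      have e1 : u + v + (u - v) = (2 : ℝ) • u := by module
      have e2 : u + v - (u - v) = (2 : ℝ) • v := by module
      rw [e1, e2, norm_smul, norm_smul, Real.norm_ofNat] at h1
      linarith
end

section
/- Let X be a real Banach space of dimension at least 2. Then S_P(X) < 1/2 if and only if X is uniformly non-square, i.e. there exists δ ∈ (0, 1) such that for all unit vectors x, y either ‖x+y‖/2 ≤ 1 − δ or ‖x−y‖/2 ≤ 1 − δ. -/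
/-- If `a, b ∈ (0, 2]`, the P-angle quotient is at most `b / 4`. -/
lemma pAngle_quotient_le {a b : ℝ} (ha : 0 < a) (hb : 0 < b) (ha2 : a ≤ 2) (hb2 : b ≤ 2) :
    (a ^ 2 + b ^ 2 - 4) / (2 * a * b) ≤ b / 4 := by
  rw [div_le_iff₀ (by positivity)]
  nlinarith [mul_nonneg (sub_nonneg.2 ha2)
    (by nlinarith : (0 : ℝ) ≤ 2 * (2 + a) - b ^ 2)]

/-- If `a, b ∈ (0, 2]`, the P-angle quotient is at most `a / 4`. -/
lemma pAngle_quotient_le' {a b : ℝ} (ha : 0 < a) (hb : 0 < b) (ha2 : a ≤ 2) (hb2 : b ≤ 2) :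
    (a ^ 2 + b ^ 2 - 4) / (2 * a * b) ≤ a / 4 := by
  have h := pAngle_quotient_le hb ha hb2 ha2
  rwa [add_comm (b ^ 2), mul_right_comm] at h

/-- If `a, b ∈ (2 * (1 - δ), 2]` with `δ` small, the P-angle quotient is close to `1 / 2`. -/
lemma lt_pAngle_quotient {a b δ : ℝ} (hδ : 0 < δ) (hδ' : δ ≤ 1 / 4)
    (ha : 2 * (1 - δ) < a) (hb : 2 * (1 - δ) < b) (ha2 : a ≤ 2) (hb2 : b ≤ 2) :
    1 / 2 - 2 * δ < (a ^ 2 + b ^ 2 - 4) / (2 * a * b) := by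
  have ha0 : 0 < a := by linarith
  have hb0 : 0 < b := by linarith
  have ha' : (2 * (1 - δ)) ^ 2 < a ^ 2 := by gcongr; linarith
  have hb' : (2 * (1 - δ)) ^ 2 < b ^ 2 := by gcongr; linarith
  have hab : a * b ≤ 4 := by nlinarith
  rw [lt_div_iff₀ (by positivity)]
  rcases le_total (1 / 2 - 2 * δ) 0 with h | h
  · nlinarith [mul_pos ha0 hb0]
  · nlinarith [mul_le_mul_of_nonneg_left hab h, sq_pos_of_pos hδ]

theorem stmt_10 (X : Type*) [NormedAddCommGroup X] [NormedSpace ℝ X] [CompleteSpace X]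
    (hdim : 2 ≤ Module.rank ℝ X) :
    SP X < 1 / 2 ↔
      ∃ δ : ℝ, δ ∈ Set.Ioo (0 : ℝ) 1 ∧ ∀ x y : X, ‖x‖ = 1 → ‖y‖ = 1 →
        ‖x + y‖ / 2 ≤ 1 - δ ∨ ‖x - y‖ / 2 ≤ 1 - δ := by
  have add_le : ∀ x y : X, ‖x‖ = 1 → ‖y‖ = 1 → ‖x + y‖ ≤ 2 := fun x y hx hy => by
    linarith [norm_add_le x y]
  have sub_le : ∀ x y : X, ‖x‖ = 1 → ‖y‖ = 1 → ‖x - y‖ ≤ 2 := fun x y hx hy => by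
    linarith [norm_sub_le x y]
  have add_pos : ∀ x y : X, x ≠ -y → 0 < ‖x + y‖ := fun x y h =>
    norm_pos_iff.2 fun h0 => h (eq_neg_of_add_eq_zero_left h0)
  have sub_pos : ∀ x y : X, x ≠ y → 0 < ‖x - y‖ := fun x y h =>
    norm_pos_iff.2 (sub_ne_zero.2 h)
  constructor
  · intro h
    refine ⟨min ((1 / 2 - SP X) / 2) (1 / 4), ⟨lt_min (by linarith) (by norm_num),
      (min_le_right _ _).trans_lt (by norm_num)⟩, ?_⟩
    set δ := min ((1 / 2 - SP X) / 2) (1 / 4)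
    have hδ0 : 0 < δ := lt_min (by linarith) (by norm_num)
    have hδ1 : δ ≤ (1 / 2 - SP X) / 2 := min_le_left _ _
    have hδ2 : δ ≤ 1 / 4 := min_le_right _ _
    intro x y hx hy
    by_contra! hxy
    obtain ⟨h1, h2⟩ := hxy
    have hlt := lt_pAngle_quotient hδ0 hδ2 (by linarith) (by linarith)
      (add_le x y hx hy) (sub_le x y hx hy)
    have hle : (‖x + y‖ ^ 2 + ‖x - y‖ ^ 2 - 4) / (2 * ‖x + y‖ * ‖x - y‖) ≤ SP X := by
      refine le_csSup ⟨1 / 2, ?_⟩ ⟨x, y, hx, hy, ?_, ?_, rfl⟩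
      · rintro r ⟨u, v, hu, hv, huv, huv', rfl⟩
        linarith [pAngle_quotient_le (add_pos u v huv') (sub_pos u v huv)
          (add_le u v hu hv) (sub_le u v hu hv), sub_le u v hu hv]
      · rintro rfl
        rw [sub_self, norm_zero] at h2
        linarith
      · rintro rfl
        rw [neg_add_cancel, norm_zero] at h1
        linarith
    linarith
  · rintro ⟨δ, ⟨hδ0, hδ1⟩, h⟩
    refine lt_of_le_of_lt (Real.sSup_le (a := (1 - δ) / 2) ?_ (by linarith)) (by linarith)
    rintro r ⟨x, y, hx, hy, hxy, hxy', rfl⟩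
    have ha := add_pos x y hxy'
    have hb := sub_pos x y hxy
    rcases h x y hx hy with h | h
    · linarith [pAngle_quotient_le' ha hb (add_le x y hx hy) (sub_le x y hx hy)]
    · linarith [pAngle_quotient_le ha hb (add_le x y hx hy) (sub_le x y hx hy)]
end

section
/- Let a < b be real numbers and let C[a, b] be the space of continuous real-valued functions on [a, b] with the supremum norm ‖x‖ = sup{|x(t)| : t ∈ [a, b]}. Then S_P(C[a, b]) = 1/2. -/
theorem div_le_half_of_norm_eq_one {X : Type*} [NormedAddCommGroup X] {x y : X}
    (hx : ‖x‖ = 1) (hy : ‖y‖ = 1) (hxy : x ≠ y) (hxy' : x ≠ -y) :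
    (‖x + y‖ ^ 2 + ‖x - y‖ ^ 2 - 4) / (2 * ‖x + y‖ * ‖x - y‖) ≤ 1 / 2 := by
  have hu : 0 < ‖x + y‖ := norm_pos_iff.2 fun h => hxy' (eq_neg_of_add_eq_zero_left h)
  have hv : 0 < ‖x - y‖ := norm_pos_iff.2 (sub_ne_zero.2 hxy)
  have hu2 : ‖x + y‖ ≤ 2 := (norm_add_le x y).trans (by linarith)
  have hv2 : ‖x - y‖ ≤ 2 := (norm_sub_le x y).trans (by linarith)
  rw [div_le_iff₀ (by positivity)]
  rcases le_total ‖x + y‖ ‖x - y‖ with h | h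
  · nlinarith [mul_nonneg hu.le (sub_nonneg.2 h)]
  · nlinarith [mul_nonneg hv.le (sub_nonneg.2 h)]

theorem exists_norm_add_eq_two_and_norm_sub_eq_two {a b : ℝ} (hab : a < b) :
    ∃ x y : C(Set.Icc a b, ℝ), ‖x‖ = 1 ∧ ‖y‖ = 1 ∧ ‖x + y‖ = 2 ∧ ‖x - y‖ = 2 := by
  have hd : 0 < b - a := sub_pos.2 hab
  let p : Set.Icc a b := ⟨a, Set.left_mem_Icc.2 hab.le⟩
  let q : Set.Icc a b := ⟨b, Set.right_mem_Icc.2 hab.le⟩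
  let y : C(Set.Icc a b, ℝ) := ⟨fun t => (2 * (t : ℝ) - a - b) / (b - a), by fun_prop⟩
  have hyp : y p = -1 := by
    change (2 * a - a - b) / (b - a) = -1
    rw [div_eq_iff hd.ne']; ring
  have hyq : y q = 1 := by
    change (2 * b - a - b) / (b - a) = 1
    rw [div_eq_iff hd.ne']; ring
  have hx : ‖(1 : C(Set.Icc a b, ℝ))‖ ≤ 1 :=
    (ContinuousMap.norm_le _ zero_le_one).2 fun t => by simp
  have hy : ‖y‖ ≤ 1 := by
    refine (ContinuousMap.norm_le _ zero_le_one).2 fun t => ?_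
    change |(2 * (t : ℝ) - a - b) / (b - a)| ≤ 1
    rw [abs_le, le_div_iff₀ hd, div_le_iff₀ hd]
    constructor <;> linarith [t.2.1, t.2.2]
  have hadd : 2 ≤ ‖1 + y‖ := by
    have h := (1 + y).norm_coe_le_norm q
    rw [ContinuousMap.add_apply, hyq] at h
    norm_num at h
    exact h
  have hsub : 2 ≤ ‖1 - y‖ := by
    have h := (1 - y).norm_coe_le_norm p
    rw [ContinuousMap.sub_apply, hyp] at h
    norm_num at h
    exact h
  have hadd' := norm_add_le 1 y
  have hsub' := norm_sub_le 1 y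
  exact ⟨1, y, by linarith, by linarith, by linarith, by linarith⟩

theorem stmt_12 (a b : ℝ) (hab : a < b) :
    SP C(Set.Icc a b, ℝ) = 1 / 2 := by
  refine IsGreatest.csSup_eq ⟨?_, ?_⟩
  · obtain ⟨x, y, hx, hy, hadd, hsub⟩ := exists_norm_add_eq_two_and_norm_sub_eq_two hab
    refine ⟨x, y, hx, hy, ?_, ?_, ?_⟩
    · rintro rfl
      simp at hsub
    · rintro rfl
      simp at hadd
    · rw [hadd, hsub]
      norm_num
  · rintro r ⟨x, y, hx, hy, hxy, hxy', rfl⟩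
    exact div_le_half_of_norm_eq_one hx hy hxy hxy'
end

section
/- Let ℓ∞ be the real sequence space of all bounded real sequences with the norm ‖x‖∞ = sup{|x_n| : n ∈ ℕ}. Then S_P(ℓ∞) = 1/2. -/
theorem lp_top_norm_eq_of_attained {f : lp (fun _ : ℕ => ℝ) ⊤} {C : ℝ}
    (hle : ∀ n, |f n| ≤ C) (k : ℕ) (hk : |f k| = C) : ‖f‖ = C := by
  apply le_antisymm
  · exact lp.norm_le_of_forall_le (hk ▸ abs_nonneg _) hle
  · rw [← hk]
    exact lp.norm_apply_le_norm ENNReal.top_ne_zero f k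

theorem sq_add_sq_sub_four_div_le_half {a b : ℝ} (ha : 0 < a) (hb : 0 < b)
    (ha2 : a ≤ 2) (hb2 : b ≤ 2) : (a ^ 2 + b ^ 2 - 4) / (2 * a * b) ≤ 1 / 2 := by
  rw [div_le_iff₀ (by positivity)]
  rcases le_total a b with h | h
  · nlinarith [mul_nonneg ha.le (sub_nonneg.2 h)]
  · nlinarith [mul_nonneg hb.le (sub_nonneg.2 h)]

theorem stmt_14 : SP (lp (fun _ : ℕ => ℝ) ⊤) = 1 / 2 := by
  refine IsGreatest.csSup_eq ⟨?_, ?_⟩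
  · let x : lp (fun _ : ℕ => ℝ) ⊤ := ⟨fun _ => 1, memℓp_infty ⟨1, by rintro _ ⟨n, rfl⟩; simp⟩⟩
    let y : lp (fun _ : ℕ => ℝ) ⊤ := ⟨fun n => if n = 0 then 1 else -1,
      memℓp_infty ⟨1, by rintro _ ⟨n, rfl⟩; dsimp only; split_ifs <;> simp⟩⟩
    have hx : ∀ n, x n = 1 := fun _ => rfl
    have hy : ∀ n, y n = if n = 0 then 1 else -1 := fun _ => rfl
    have hadd : ∀ n, (x + y) n = x n + y n := fun _ => rfl
    have hsub : ∀ n, (x - y) n = x n - y n := fun _ => rfl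
    have hnx : ‖x‖ = 1 := lp_top_norm_eq_of_attained (fun n => by simp [hx]) 0 (by simp [hx])
    have hny : ‖y‖ = 1 :=
      lp_top_norm_eq_of_attained (fun n => by rw [hy]; split_ifs <;> simp) 0 (by simp [hy])
    have hnadd : ‖x + y‖ = 2 :=
      lp_top_norm_eq_of_attained (fun n => by rw [hadd, hx, hy]; split_ifs <;> norm_num) 0
        (by rw [hadd, hx, hy]; norm_num)
    have hnsub : ‖x - y‖ = 2 :=
      lp_top_norm_eq_of_attained (fun n => by rw [hsub, hx, hy]; split_ifs <;> norm_num) 1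
        (by rw [hsub, hx, hy]; norm_num)
    refine ⟨x, y, hnx, hny, fun h => ?_, fun h => ?_, ?_⟩
    · rw [h, sub_self, norm_zero] at hnsub
      norm_num at hnsub
    · rw [h, neg_add_cancel, norm_zero] at hnadd
      norm_num at hnadd
    · rw [hnadd, hnsub]
      norm_num
  · rintro r ⟨x, y, hx, hy, hne, hne', rfl⟩
    refine sq_add_sq_sub_four_div_le_half (norm_pos_iff.2 fun h => hne' (eq_neg_of_add_eq_zero_left h))
      (norm_pos_iff.2 (sub_ne_zero.2 hne)) ?_ ?_
    · linarith [norm_add_le x y]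
    · linarith [norm_sub_le x y]
end

section
/- Let X be a real Banach space of dimension at least 2. If S_P(X) = 1/2, then X is not uniformly convex; i.e., there exists ε ∈ (0, 2] such that for every δ > 0 there are unit vectors x, y with ‖x − y‖ ≥ ε and ‖x + y‖/2 > 1 − δ. -/
/-- The elementary estimate behind the theorem: if `b ≤ a ≤ 2` and the P-angle quotient is close to
`1 / 2`, then `a` is close to `2` and `b` is bounded below. -/
lemma bounds_of_lt_pAngle_quotient {a b η : ℝ} (hb : 0 < b) (hba : b ≤ a) (ha : a ≤ 2)
    (hη : 0 < η) (hη' : η ≤ 1 / 4)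
    (h : 1 / 2 - η / 2 < (a ^ 2 + b ^ 2 - 4) / (2 * a * b)) :
    1 ≤ b ∧ 1 - η < a / 2 := by
  have ha0 : 0 < a := hb.trans_le hba
  rw [lt_div_iff₀ (by positivity)] at h
  have hab : a * b ≤ 4 := by nlinarith
  have hη_ab : η * (a * b) ≤ η * 4 := mul_le_mul_of_nonneg_left hab hη.le
  have hbb : b ^ 2 ≤ a * b := by nlinarith
  have ha_lower : 2 - 2 * η < a := by nlinarith
  have hb_lower : (1 - η) * a < b := by
    refine lt_of_mul_lt_mul_right ?_ hb.le
    nlinarith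
  exact ⟨by nlinarith, by linarith⟩

theorem stmt_18 (X : Type*) [NormedAddCommGroup X] [NormedSpace ℝ X] [CompleteSpace X]
    (hdim : 2 ≤ Module.rank ℝ X) (h : SP X = 1 / 2) :
    ∃ ε : ℝ, ε ∈ Set.Ioc (0 : ℝ) 2 ∧ ∀ δ : ℝ, 0 < δ →
      ∃ x y : X, ‖x‖ = 1 ∧ ‖y‖ = 1 ∧ ε ≤ ‖x - y‖ ∧ 1 - δ < ‖x + y‖ / 2 := by
  refine ⟨1, by norm_num, fun δ hδ => ?_⟩
  obtain ⟨η, hη, hηδ, hη'⟩ : ∃ η : ℝ, 0 < η ∧ η ≤ δ ∧ η ≤ 1 / 4 :=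
    ⟨min δ (1 / 4), by positivity, min_le_left _ _, min_le_right _ _⟩
  have hne : {r : ℝ | ∃ x y : X, ‖x‖ = 1 ∧ ‖y‖ = 1 ∧ x ≠ y ∧ x ≠ -y ∧
      r = (‖x + y‖ ^ 2 + ‖x - y‖ ^ 2 - 4) / (2 * ‖x + y‖ * ‖x - y‖)}.Nonempty := by
    by_contra hempty
    rw [Set.not_nonempty_iff_eq_empty] at hempty
    rw [SP, hempty, Real.sSup_empty] at h
    norm_num at h
  obtain ⟨_, ⟨x, y, hx, hy, hxy, hxy', rfl⟩, hr⟩ :=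
    exists_lt_of_lt_csSup hne (show 1 / 2 - η / 2 < SP X by rw [h]; linarith)
  have hadd : 0 < ‖x + y‖ := norm_pos_iff.2 fun h0 => hxy' (eq_neg_of_add_eq_zero_left h0)
  have hsub : 0 < ‖x - y‖ := norm_pos_iff.2 (sub_ne_zero.2 hxy)
  have hadd2 : ‖x + y‖ ≤ 2 := (norm_add_le x y).trans (by rw [hx, hy]; norm_num)
  have hsub2 : ‖x - y‖ ≤ 2 := (norm_sub_le x y).trans (by rw [hx, hy]; norm_num)
  rcases le_total ‖x - y‖ ‖x + y‖ with hle | hle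
  · obtain ⟨h1, h2⟩ := bounds_of_lt_pAngle_quotient hsub hle hadd2 hη hη' hr
    exact ⟨x, y, hx, hy, h1, by linarith⟩
  · rw [add_comm (‖x + y‖ ^ 2), mul_right_comm] at hr
    obtain ⟨h1, h2⟩ := bounds_of_lt_pAngle_quotient hadd hle hsub2 hη hη' hr
    refine ⟨x, -y, hx, by rwa [norm_neg], by rwa [sub_neg_eq_add], ?_⟩
    rw [← sub_eq_add_neg]
    linarith
end

section
/- Let X be a finite-dimensional real Banach space of dimension at least 2. If S_P(X) = 1/2, then X is not strictly convex; i.e., there exist unit vectors x, y with x ≠ y such that ‖x + y‖ = 2. -/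
/-- Two unit vectors whose P-angle ratio exceeds `1 / 4` have a sum of norm at least `1 / 2`. -/
theorem half_le_norm_add_of_quarter_lt {X : Type*} [NormedAddCommGroup X] [NormedSpace ℝ X]
    {x y : X} (hx : ‖x‖ = 1) (hy : ‖y‖ = 1) (hadd : 0 < ‖x + y‖) (hsub : 0 < ‖x - y‖)
    (hr : 1 / 4 < (‖x + y‖ ^ 2 + ‖x - y‖ ^ 2 - 4) / (2 * ‖x + y‖ * ‖x - y‖)) :
    1 / 2 ≤ ‖x + y‖ := by
  have hle : ‖x - y‖ ≤ 2 := by linarith [norm_sub_le x y]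
  have htwo : 2 ≤ ‖x + y‖ + ‖x - y‖ := by
    have h := norm_add_le (x + y) (x - y)
    rwa [show x + y + (x - y) = (2 : ℝ) • x by module, norm_smul, hx, Real.norm_ofNat,
      mul_one] at h
  rw [lt_div_iff₀ (by positivity)] at hr
  have hlt : ‖x - y‖ < 2 * ‖x + y‖ := by
    by_contra! hge
    nlinarith [mul_le_mul_of_nonneg_left hge hadd.le]
  linarith

theorem stmt_19 (X : Type*) [NormedAddCommGroup X] [NormedSpace ℝ X]
    [FiniteDimensional ℝ X] (hdim : 2 ≤ Module.rank ℝ X) (h : SP X = 1 / 2) :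
    ∃ x y : X, ‖x‖ = 1 ∧ ‖y‖ = 1 ∧ x ≠ y ∧ ‖x + y‖ = 2 := by
  have : ProperSpace X := FiniteDimensional.proper_real X
  set S : Set ℝ := {r : ℝ | ∃ x y : X, ‖x‖ = 1 ∧ ‖y‖ = 1 ∧ x ≠ y ∧ x ≠ -y ∧
    r = (‖x + y‖ ^ 2 + ‖x - y‖ ^ 2 - 4) / (2 * ‖x + y‖ * ‖x - y‖)}
  have hsup : sSup S = 1 / 2 := h
  let f : X × X → ℝ := fun p =>
    (‖p.1 + p.2‖ ^ 2 + ‖p.1 - p.2‖ ^ 2 - 4) / (2 * ‖p.1 + p.2‖ * ‖p.1 - p.2‖)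
  let K : Set (X × X) := (Metric.sphere 0 1 ×ˢ Metric.sphere 0 1) ∩
    {p | 1 / 2 ≤ ‖p.1 + p.2‖ ∧ 1 / 2 ≤ ‖p.1 - p.2‖}
  have hK : IsCompact K := by
    refine ((isCompact_sphere 0 1).prod (isCompact_sphere 0 1)).inter_right ?_
    rw [Set.ofPred_and]
    exact (isClosed_le (by fun_prop) (by fun_prop)).inter
      (isClosed_le (by fun_prop) (by fun_prop))
  have hf : ContinuousOn f K := by
    refine ContinuousOn.div (by fun_prop) (by fun_prop) fun p hp => ?_
    have h₁ : 0 < ‖p.1 + p.2‖ := by linarith [hp.2.1]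
    have h₂ : 0 < ‖p.1 - p.2‖ := by linarith [hp.2.2]
    positivity
  have hmem : ∀ r ∈ S, 1 / 4 < r → ∃ p ∈ K, f p = r := by
    rintro r ⟨x, y, hx, hy, hne, hne', rfl⟩ hr
    have hadd : 0 < ‖x + y‖ := norm_pos_iff.2 fun h0 => hne' (eq_neg_of_add_eq_zero_left h0)
    have hsub : 0 < ‖x - y‖ := norm_pos_iff.2 (sub_ne_zero.2 hne)
    refine ⟨(x, y), ⟨⟨by simpa using hx, by simpa using hy⟩,
      half_le_norm_add_of_quarter_lt hx hy hadd hsub hr, ?_⟩, rfl⟩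
    have hswap := half_le_norm_add_of_quarter_lt (x := x) (y := -y) hx (by simpa using hy)
    rw [← sub_eq_add_neg, sub_neg_eq_add] at hswap
    refine hswap hsub hadd ?_
    convert hr using 1
    ring
  have hSne : S.Nonempty := by
    by_contra hempty
    rw [Set.not_nonempty_iff_eq_empty.1 hempty, Real.sSup_empty] at hsup
    norm_num at hsup
  have hKne : K.Nonempty := by
    obtain ⟨r, hrS, hr⟩ := exists_lt_of_lt_csSup hSne (show 1 / 4 < sSup S by rw [hsup]; norm_num)
    obtain ⟨p, hp, -⟩ := hmem r hrS hr
    exact ⟨p, hp⟩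
  obtain ⟨⟨x, y⟩, hxy, hmax⟩ := hK.exists_isMaxOn hKne hf
  have hhalf : 1 / 2 ≤ f (x, y) := by
    by_contra! hlt
    obtain ⟨r, hrS, hr⟩ := exists_lt_of_lt_csSup hSne
      (show max (1 / 4) (f (x, y)) < sSup S by rw [hsup]; exact max_lt (by norm_num) hlt)
    obtain ⟨p, hp, rfl⟩ := hmem r hrS ((le_max_left _ _).trans_lt hr)
    exact absurd (hmax hp) (not_le.2 ((le_max_right _ _).trans_lt hr))
  obtain ⟨⟨hx, hy⟩, hadd, hsub⟩ := hxy
  simp only [mem_sphere_iff_norm, sub_zero] at hx hy hadd hsub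
  refine ⟨x, y, hx, hy, ?_, ?_⟩
  · rintro rfl
    norm_num at hsub
  · have hadd2 : ‖x + y‖ ≤ 2 := by linarith [norm_add_le x y]
    have hsub2 : ‖x - y‖ ≤ 2 := by linarith [norm_sub_le x y]
    have hkey : 1 / 2 ≤ (‖x + y‖ ^ 2 + ‖x - y‖ ^ 2 - 4) / (2 * ‖x + y‖ * ‖x - y‖) := hhalf
    rw [le_div_iff₀ (by nlinarith)] at hkey
    refine hadd2.antisymm ?_
    by_contra! hlt
    nlinarith [mul_nonneg (by linarith : 0 ≤ ‖x - y‖) (sub_nonneg.2 hsub2),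
      mul_pos (sub_pos.2 hlt) (by linarith : 0 < ‖x + y‖),
      mul_nonneg (sub_nonneg.2 hsub2) (sub_nonneg.2 hadd2)]
end
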